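/- Let U ⊂ ℝ^n be open bounded convex with diameter d, f ∈ C^1(U̅), ω ≥ 0 with ∫_U ω = 1, and t = (n−1)p/n ≥ 1. Extending ω and df by zero outside U, one has ∫_U |f(x) − E_ω[f]|^t dx ≤ d^{n+t−1} ∫_U ω̃(z) |df_z|^t dz, where ω̃(z) = ∫_{ℝ^n} ω(z − x) χ_{|x| ≤ d} |x|^{-(n-1)} dx. -/

import Mathlib

open MeasureTheory Set ENNReal

noncomputable def auxN {E : Type*} [NormedAddCommGroup E] (d t : ℝ) (h : E) : ℝ≥0∞ :=
  Set.indicator {x : E | ‖x‖ ≤ d} (fun x => ENNReal.ofReal (‖x‖ ^ t)) h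

lemma auxN_meas {E : Type*} [NormedAddCommGroup E] [MeasurableSpace E] [BorelSpace E] (d t : ℝ) :
    Measurable (auxN d t : E → ℝ≥0∞) := by
  unfold auxN
  refine Measurable.indicator (by fun_prop) ?_
  exact measurableSet_le (by fun_prop) (by fun_prop)

lemma aux_kernel {E : Type*} [NormedAddCommGroup E] [NormedSpace ℝ E] (n : ℕ) (hn : 2 ≤ n)
    (d t : ℝ) (ht1 : 1 ≤ t) (w : E) (hw : w ≠ 0) :
    ∫⁻ u in Ioo (0:ℝ) 1, ENNReal.ofReal ((u ^ n)⁻¹) * auxN d t (u⁻¹ • w) ≤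
      ENNReal.ofReal (d ^ (n + t - 1)) * auxN d (-((n:ℝ) - 1)) w := by
  have hw0 : 0 < ‖w‖ := norm_pos_iff.2 hw
  have hn' : (2:ℝ) ≤ n := by exact_mod_cast hn
  by_cases hwd : ‖w‖ ≤ d
  swap
  · have : ∫⁻ u in Ioo (0:ℝ) 1, ENNReal.ofReal ((u ^ n)⁻¹) * auxN d t (u⁻¹ • w) = 0 := by
      rw [setLIntegral_congr_fun (g := fun _ => 0) measurableSet_Ioo]
      · simp
      · intro u hu
        have h1 : 1 ≤ u⁻¹ := (one_le_inv₀ hu.1).2 hu.2.le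
        have : ¬ (‖u⁻¹ • w‖ ≤ d) := by
          rw [norm_smul, Real.norm_of_nonneg (by linarith)]
          push Not at hwd ⊢
          nlinarith
        simp only [auxN]
        rw [indicator_of_notMem (by simpa using this), mul_zero]
    rw [this]; exact zero_le
  have hd : 0 < d := hw0.trans_le hwd
  set c := ‖w‖ / d with hc
  have hc0 : 0 < c := by positivity
  have ha : -((n:ℝ) + t) < -1 := by linarith
  calc ∫⁻ u in Ioo (0:ℝ) 1, ENNReal.ofReal ((u ^ n)⁻¹) * auxN d t (u⁻¹ • w)
      ≤ ∫⁻ u in Ioo (0:ℝ) 1, (Ici c).indicator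
          (fun u => ENNReal.ofReal (‖w‖ ^ t * u ^ (-((n:ℝ) + t)))) u := by
        refine setLIntegral_mono' measurableSet_Ioo ?_
        intro u hu
        have hu0 := hu.1
        by_cases h : ‖u⁻¹ • w‖ ≤ d
        · have hnorm : ‖u⁻¹ • w‖ = u⁻¹ * ‖w‖ := by
            rw [norm_smul, Real.norm_of_nonneg (by positivity)]
          have hcu : u ∈ Ici c := by
            rw [hnorm, inv_mul_le_iff₀ hu0] at h
            rw [mem_Ici, hc, div_le_iff₀ hd]; exact h
          rw [indicator_of_mem hcu, auxN, indicator_of_mem (by simpa using h),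
            ← ENNReal.ofReal_mul (by positivity), hnorm]
          apply ENNReal.ofReal_le_ofReal
          rw [Real.mul_rpow (by positivity) (by positivity), Real.inv_rpow hu0.le,
            Real.rpow_neg hu0.le, Real.rpow_add hu0, Real.rpow_natCast, mul_inv]
          apply le_of_eq; ring
        · rw [auxN, indicator_of_notMem (by simpa using h), mul_zero]; exact zero_le
    _ ≤ ∫⁻ u, (Ici c).indicator
          (fun u => ENNReal.ofReal (‖w‖ ^ t * u ^ (-((n:ℝ) + t)))) u :=
        setLIntegral_le_lintegral _ _
    _ = ∫⁻ u in Ioi c, ENNReal.ofReal (‖w‖ ^ t * u ^ (-((n:ℝ) + t))) := by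
        rw [lintegral_indicator measurableSet_Ici, setLIntegral_congr Ioi_ae_eq_Ici]
    _ = ENNReal.ofReal (∫ u in Ioi c, (‖w‖ ^ t * u ^ (-((n:ℝ) + t)))) := by
        rw [ofReal_integral_eq_lintegral_ofReal]
        · exact (integrableOn_Ioi_rpow_of_lt ha hc0).const_mul _
        · filter_upwards [ae_restrict_mem measurableSet_Ioi] with u hu
          have : 0 < u := hc0.trans hu
          simp only [Pi.zero_apply]
          positivity
    _ ≤ ENNReal.ofReal (d ^ (n + t - 1)) * auxN d (-((n:ℝ) - 1)) w := by
        rw [auxN, indicator_of_mem (by simpa using hwd), ← ENNReal.ofReal_mul (by positivity)]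
        apply ENNReal.ofReal_le_ofReal
        rw [integral_const_mul, integral_Ioi_rpow_of_lt ha hc0]
        have e1 : c ^ (-((n:ℝ) + t) + 1) = ‖w‖ ^ (-((n:ℝ) + t) + 1) * d ^ (n + t - 1) := by
          rw [hc, Real.div_rpow hw0.le hd.le, div_eq_mul_inv, ← Real.rpow_neg hd.le]
          congr 2; ring
        have e2 : ‖w‖ ^ t * ‖w‖ ^ (-((n:ℝ) + t) + 1) = ‖w‖ ^ (-((n:ℝ) - 1)) := by
          rw [← Real.rpow_add hw0]; congr 1; ring
        have e3 : ‖w‖ ^ t * (-c ^ (-((n:ℝ) + t) + 1) / (-((n:ℝ) + t) + 1))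
            = (d ^ (n + t - 1) * ‖w‖ ^ (-((n:ℝ) - 1))) / (n + t - 1) := by
          rw [e1, ← e2]
          have : (-((n:ℝ) + t) + 1) = - (n + t - 1) := by ring
          rw [this, neg_div_neg_eq]; ring
        rw [e3]
        apply div_le_self (by positivity)
        linarith

lemma aux_scale {n : ℕ} (u : ℝ) (hu : 0 < u) (F : EuclideanSpace ℝ (Fin n) → ℝ≥0∞)
    (hF : Measurable F) :
    ∫⁻ h, F (u • h) = ENNReal.ofReal ((u ^ n)⁻¹) * ∫⁻ w, F w := by
  have := Measure.map_addHaar_smul (volume : Measure (EuclideanSpace ℝ (Fin n))) hu.ne'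
  rw [← lintegral_map (μ := volume) hF (measurable_const_smul u), this, lintegral_smul_measure]
  simp [abs_of_pos hu]

lemma aux_core (n : ℕ) (hn : 2 ≤ n) (d t : ℝ) (ht1 : 1 ≤ t)
    (W G : EuclideanSpace ℝ (Fin n) → ℝ≥0∞) (hW : Measurable W) (hG : Measurable G) :
    ∫⁻ y, W y * ∫⁻ h, auxN d t h * ∫⁻ u in Ioo (0:ℝ) 1, G (y + u • h) ≤
      ENNReal.ofReal (d ^ (n + t - 1)) *
        ∫⁻ z, G z * ∫⁻ w, W (z - w) * auxN d (-((n:ℝ) - 1)) w := by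
  have hN : Measurable (auxN d t : EuclideanSpace ℝ (Fin n) → ℝ≥0∞) := auxN_meas d t
  have hK : Measurable (auxN d (-((n:ℝ) - 1)) : EuclideanSpace ℝ (Fin n) → ℝ≥0∞) := auxN_meas d _
  have : Nontrivial (EuclideanSpace ℝ (Fin n)) := by
    have : Nonempty (Fin n) := ⟨⟨0, by omega⟩⟩
    infer_instance
  calc ∫⁻ y, W y * ∫⁻ h, auxN d t h * ∫⁻ u in Ioo (0:ℝ) 1, G (y + u • h)
      = ∫⁻ y, ∫⁻ h, ∫⁻ u in Ioo (0:ℝ) 1, W y * (auxN d t h * G (y + u • h)) := by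
        refine lintegral_congr fun y => ?_
        rw [← lintegral_const_mul _ (by fun_prop)]
        refine lintegral_congr fun h => ?_
        rw [← lintegral_const_mul _ (by fun_prop), ← lintegral_const_mul _ (by fun_prop)]
    _ = ∫⁻ y, ∫⁻ u in Ioo (0:ℝ) 1, ∫⁻ h, W y * (auxN d t h * G (y + u • h)) := by
        refine lintegral_congr fun y => ?_
        rw [lintegral_lintegral_swap]
        exact Measurable.aemeasurable (by unfold Function.uncurry; fun_prop)
    _ = ∫⁻ u in Ioo (0:ℝ) 1, ∫⁻ y, ∫⁻ h, W y * (auxN d t h * G (y + u • h)) := by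
        rw [lintegral_lintegral_swap]
        refine Measurable.aemeasurable (Measurable.lintegral_prod_right'
          (f := fun q : (EuclideanSpace ℝ (Fin n) × ℝ) × EuclideanSpace ℝ (Fin n) =>
            W q.1.1 * (auxN d t q.2 * G (q.1.1 + q.1.2 • q.2))) ?_)
        fun_prop
    _ = ∫⁻ u in Ioo (0:ℝ) 1, ∫⁻ z, ∫⁻ h, W (z - u • h) * (auxN d t h * G z) := by
        refine lintegral_congr fun u => ?_
        conv_lhs => rw [lintegral_lintegral_swap (by
          exact Measurable.aemeasurable (by unfold Function.uncurry; fun_prop))]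
        conv_rhs => rw [lintegral_lintegral_swap (by
          exact Measurable.aemeasurable (by unfold Function.uncurry; fun_prop))]
        · refine lintegral_congr fun h => ?_
          have e := lintegral_sub_right_eq_self (μ := volume)
            (fun y => W y * (auxN d t h * G (y + u • h))) (u • h)
          rw [← e]
          simp
    _ = ∫⁻ u in Ioo (0:ℝ) 1, ∫⁻ z, ∫⁻ w,
          ENNReal.ofReal ((u ^ n)⁻¹) * (W (z - w) * (auxN d t (u⁻¹ • w) * G z)) := by
        refine setLIntegral_congr_fun measurableSet_Ioo fun u hu => ?_
        refine lintegral_congr fun z => ?_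
        rw [lintegral_const_mul _ (by fun_prop), ← aux_scale u hu.1 _ (by fun_prop)]
        simp [smul_smul, inv_mul_cancel₀ hu.1.ne']
    _ = ∫⁻ z, ∫⁻ u in Ioo (0:ℝ) 1, ∫⁻ w,
          ENNReal.ofReal ((u ^ n)⁻¹) * (W (z - w) * (auxN d t (u⁻¹ • w) * G z)) := by
        rw [lintegral_lintegral_swap]
        refine Measurable.aemeasurable (Measurable.lintegral_prod_right'
          (f := fun q : (ℝ × EuclideanSpace ℝ (Fin n)) × EuclideanSpace ℝ (Fin n) =>
            ENNReal.ofReal ((q.1.1 ^ n)⁻¹) *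
              (W (q.1.2 - q.2) * (auxN d t (q.1.1⁻¹ • q.2) * G q.1.2))) ?_)
        fun_prop
    _ = ∫⁻ z, ∫⁻ w, ∫⁻ u in Ioo (0:ℝ) 1,
          ENNReal.ofReal ((u ^ n)⁻¹) * (W (z - w) * (auxN d t (u⁻¹ • w) * G z)) := by
        refine lintegral_congr fun z => ?_
        rw [lintegral_lintegral_swap]
        exact Measurable.aemeasurable (by unfold Function.uncurry; fun_prop)
    _ ≤ ∫⁻ z, ∫⁻ w, ENNReal.ofReal (d ^ (n + t - 1)) *
          (G z * (W (z - w) * auxN d (-((n:ℝ) - 1)) w)) := by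
        refine lintegral_mono fun z => lintegral_mono_ae ?_
        have h0 : ∀ᵐ w : EuclideanSpace ℝ (Fin n), w ≠ 0 := Measure.ae_ne volume 0
        filter_upwards [h0] with w hw
        calc _ = ∫⁻ u in Ioo (0:ℝ) 1, (W (z - w) * G z) *
                (ENNReal.ofReal ((u ^ n)⁻¹) * auxN d t (u⁻¹ • w)) := by
              refine lintegral_congr fun u => ?_
              ring
          _ = (W (z - w) * G z) * ∫⁻ u in Ioo (0:ℝ) 1,
                (ENNReal.ofReal ((u ^ n)⁻¹) * auxN d t (u⁻¹ • w)) := by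
              rw [lintegral_const_mul _ (by fun_prop)]
          _ ≤ (W (z - w) * G z) * (ENNReal.ofReal (d ^ (n + t - 1)) * auxN d (-((n:ℝ) - 1)) w) := by
              gcongr
              exact aux_kernel n hn d t ht1 w hw
          _ = _ := by ring
    _ = _ := by
        rw [← lintegral_const_mul]
        · refine lintegral_congr fun z => ?_
          rw [lintegral_const_mul _ (by fun_prop), lintegral_const_mul _ (by fun_prop)]
        · refine hG.mul (Measurable.lintegral_prod_right'
            (f := fun q : EuclideanSpace ℝ (Fin n) × EuclideanSpace ℝ (Fin n) =>
             W (q.1 - q.2) * auxN d (-((n:ℝ) - 1)) q.2) ?_)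
          fun_prop

lemma aux_jensen {α : Type*} [MeasurableSpace α] (μ : Measure α) [IsProbabilityMeasure μ]
    (g : α → ℝ≥0∞) (hg : AEMeasurable g μ) (t : ℝ) (ht1 : 1 ≤ t) :
    (∫⁻ a, g a ∂μ) ^ t ≤ ∫⁻ a, g a ^ t ∂μ := by
  have := eLpNorm'_le_eLpNorm'_of_exponent_le one_pos ht1 μ hg.aestronglyMeasurable
  simp only [eLpNorm', enorm_eq_self, ENNReal.rpow_one, div_one, one_div] at this
  rwa [ENNReal.le_rpow_inv_iff (by linarith)] at this

lemma aux_Kint (n : ℕ) (hn : 2 ≤ n) (d : ℝ) :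
    Integrable (Set.indicator {x : EuclideanSpace ℝ (Fin n) | ‖x‖ ≤ d}
                (fun x => ‖x‖ ^ (-((n : ℝ) - 1)))) := by
  have : Nontrivial (EuclideanSpace ℝ (Fin n)) := by
    have : Nonempty (Fin n) := ⟨⟨0, by omega⟩⟩
    infer_instance
  have h := integrable_fun_norm_addHaar (volume : Measure (EuclideanSpace ℝ (Fin n)))
    (f := (Iic d).indicator (fun r : ℝ => r ^ (-((n : ℝ) - 1))))
  have e : (fun x : EuclideanSpace ℝ (Fin n) =>
    (Iic d).indicator (fun r : ℝ => r ^ (-((n : ℝ) - 1))) ‖x‖) =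
     (Set.indicator {x : EuclideanSpace ℝ (Fin n) | ‖x‖ ≤ d}
                (fun x => ‖x‖ ^ (-((n : ℝ) - 1)))) := by
    ext x; simp [indicator]
  rw [e] at h
  rw [h]
  have : IntegrableOn ((Iic d).indicator (fun _ : ℝ => (1:ℝ))) (Ioi 0) := by
    rw [IntegrableOn, integrable_indicator_iff measurableSet_Iic, IntegrableOn,
      Measure.restrict_restrict measurableSet_Iic, inter_comm, Ioi_inter_Iic]
    simp
  refine this.congr_fun ?_ measurableSet_Ioi
  intro r hr
  have hr : 0 < r := hr
  by_cases hrd : r ≤ d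
  · simp only [finrank_euclideanSpace, Fintype.card_fin, smul_eq_mul]
    rw [indicator_of_mem (by simpa using hrd), indicator_of_mem (by simpa using hrd)]
    rw [Real.rpow_neg hr.le]
    have : (n:ℝ) - 1 = ((n-1 : ℕ) : ℝ) := by rw [Nat.cast_sub (by omega)]; simp
    rw [this, Real.rpow_natCast, mul_inv_cancel₀ (by positivity)]
  · simp [hrd]

lemma aux_pointwise (n : ℕ) (U : Set (EuclideanSpace ℝ (Fin n)))
    (hUo : IsOpen U) (hUc : Convex ℝ U)
    (f : EuclideanSpace ℝ (Fin n) → ℝ) (hf : ContDiffOn ℝ 1 f (closure U))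
    (t : ℝ) (ht1 : 1 ≤ t) (x y : EuclideanSpace ℝ (Fin n)) (hx : x ∈ U) (hy : y ∈ U) :
    ‖f x - f y‖ₑ ^ t ≤ ‖x - y‖ₑ ^ t * ∫⁻ u in Ioo (0:ℝ) 1,
      U.indicator (fun z => ‖fderivWithin ℝ f (closure U) z‖ₑ ^ t) (y + u • (x - y)) := by
  have hUD : UniqueDiffOn ℝ (closure U) := uniqueDiffOn_convex hUc.closure
    ⟨x, interior_mono subset_closure (by rwa [hUo.interior_eq])⟩
  have hcD : ContinuousOn (fderivWithin ℝ f (closure U)) (closure U) :=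
    hf.continuousOn_fderivWithin hUD le_rfl
  have hmem : ∀ u ∈ Icc (0:ℝ) 1, y + u • (x - y) ∈ U := fun u hu =>
    hUc.add_smul_sub_mem hy hx hu
  have hγ : Continuous (fun u : ℝ => y + u • (x - y)) := by fun_prop
  have hcl : ContinuousOn (fun u : ℝ => fderivWithin ℝ f (closure U) (y + u • (x - y)))
      (Icc 0 1) :=
    hcD.comp hγ.continuousOn fun u hu => subset_closure (hmem u hu)
  have hder : ∀ u ∈ uIcc (0:ℝ) 1, HasDerivAt (fun u : ℝ => f (y + u • (x - y)))
      (fderivWithin ℝ f (closure U) (y + u • (x - y)) (x - y)) u := by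
    intro u hu
    rw [uIcc_of_le zero_le_one] at hu
    have hz := hmem u hu
    have hnhds : closure U ∈ nhds (y + u • (x - y)) :=
      Filter.mem_of_superset (hUo.mem_nhds hz) subset_closure
    have h1 : HasFDerivAt f (fderivWithin ℝ f (closure U) (y + u • (x - y))) (y + u • (x - y)) :=
      ((hf.differentiableOn one_ne_zero _ (subset_closure hz)).hasFDerivWithinAt).hasFDerivAt hnhds
    have h2 : HasDerivAt (fun u : ℝ => y + u • (x - y)) (x - y) u := by
      simpa using ((hasDerivAt_id u).smul_const (x - y)).const_add y
    exact h1.comp_hasDerivAt u h2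
  have hint : IntervalIntegrable
      (fun u : ℝ => fderivWithin ℝ f (closure U) (y + u • (x - y)) (x - y)) volume 0 1 := by
    apply ContinuousOn.intervalIntegrable
    rw [uIcc_of_le zero_le_one]
    exact hcl.clm_apply continuousOn_const
  have hftc := intervalIntegral.integral_eq_sub_of_hasDerivAt hder hint
  simp only [one_smul, zero_smul, add_zero, add_sub_cancel] at hftc
  rw [intervalIntegral.integral_of_le zero_le_one, integral_Ioc_eq_integral_Ioo] at hftc
  have hprob : IsProbabilityMeasure (volume.restrict (Ioo (0:ℝ) 1)) := ⟨by simp⟩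
  have hmeas : AEMeasurable (fun u : ℝ => ‖fderivWithin ℝ f (closure U) (y + u • (x - y))‖ₑ)
      (volume.restrict (Ioo (0:ℝ) 1)) :=
    ((hcl.mono Ioo_subset_Icc_self).enorm).aemeasurable measurableSet_Ioo
  calc ‖f x - f y‖ₑ ^ t
      ≤ (∫⁻ u in Ioo (0:ℝ) 1, ‖fderivWithin ℝ f (closure U) (y + u • (x - y))‖ₑ * ‖x - y‖ₑ) ^ t := by
        rw [← hftc]
        gcongr
        refine (enorm_integral_le_lintegral_enorm _).trans ?_
        exact lintegral_mono fun u => ContinuousLinearMap.le_opENorm _ _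
    _ = ‖x - y‖ₑ ^ t * (∫⁻ u in Ioo (0:ℝ) 1, ‖fderivWithin ℝ f (closure U) (y + u • (x - y))‖ₑ) ^ t := by
        rw [lintegral_mul_const' _ _ enorm_ne_top, ENNReal.mul_rpow_of_nonneg _ _ (by linarith), mul_comm]
    _ ≤ ‖x - y‖ₑ ^ t * (∫⁻ u in Ioo (0:ℝ) 1, ‖fderivWithin ℝ f (closure U) (y + u • (x - y))‖ₑ ^ t) := by
        gcongr
        exact aux_jensen _ _ hmeas t ht1
    _ = _ := by
        congr 1
        refine setLIntegral_congr_fun measurableSet_Ioo fun u hu => ?_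
        rw [indicator_of_mem (hmem u (Ioo_subset_Icc_self hu))]

theorem stmt15 (n : ℕ) (hn : 2 ≤ n) (U : Set (EuclideanSpace ℝ (Fin n)))
    (hUo : IsOpen U) (hUne : U.Nonempty) (hUb : Bornology.IsBounded U) (hUc : Convex ℝ U)
    (d : ℝ) (hd : Metric.diam U = d)
    (f ω : EuclideanSpace ℝ (Fin n) → ℝ)
    (hf : ContDiffOn ℝ 1 f (closure U))
    (hω : ∀ x, 0 ≤ ω x) (hω1 : (∫ y in U, ω y) = 1)
    (p t : ℝ) (ht : t = (n - 1) * p / n) (ht1 : 1 ≤ t) :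
    (∫⁻ x in U, ENNReal.ofReal (|f x - ∫ y in U, f y * ω y| ^ t)) ≤
      ENNReal.ofReal (d ^ (n + t - 1)) *
        ∫⁻ z in U, ENNReal.ofReal
          ((∫ x, Set.indicator U ω (z - x) *
              Set.indicator {x : EuclideanSpace ℝ (Fin n) | ‖x‖ ≤ d}
                (fun x => ‖x‖ ^ (-((n : ℝ) - 1))) x) *
            ‖fderivWithin ℝ f (closure U) z‖ ^ t) := by
  have ht0 : 0 ≤ t := by linarith
  have hUm : MeasurableSet U := hUo.measurableSet
  have hofr : ∀ a : ℝ, ENNReal.ofReal (|a| ^ t) = ‖a‖ₑ ^ t := fun a => by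
    rw [← ENNReal.ofReal_rpow_of_nonneg (abs_nonneg a) ht0, Real.enorm_eq_ofReal_abs]
  have hUD : UniqueDiffOn ℝ (closure U) := by
    obtain ⟨x, hx⟩ := hUne
    exact uniqueDiffOn_convex hUc.closure
      ⟨x, interior_mono subset_closure (by rwa [hUo.interior_eq])⟩
  have hcD : ContinuousOn (fderivWithin ℝ f (closure U)) (closure U) :=
    hf.continuousOn_fderivWithin hUD le_rfl
  have hωint : IntegrableOn ω U := by
    by_contra h
    rw [integral_undef h] at hω1
    exact zero_ne_one hω1
  set ω₀ := hωint.aestronglyMeasurable.mk ω with hω₀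
  have hω₀m : Measurable ω₀ := hωint.aestronglyMeasurable.stronglyMeasurable_mk.measurable
  have hω₀e : ω =ᵐ[volume.restrict U] ω₀ := hωint.aestronglyMeasurable.ae_eq_mk
  set W : EuclideanSpace ℝ (Fin n) → ℝ≥0∞ := U.indicator (fun y => ENNReal.ofReal (ω₀ y)) with hWdef
  have hWm : Measurable W := (hω₀m.ennreal_ofReal).indicator hUm
  have hWe : W =ᵐ[volume] fun y => ENNReal.ofReal (U.indicator ω y) := by
    have := (ae_restrict_iff' hUm).1 hω₀e
    filter_upwards [this] with y hy
    by_cases hyU : y ∈ U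
    · simp [hWdef, hyU, hy hyU]
    · simp [hWdef, hyU]
  have hW1 : ∫⁻ y, W y = 1 := by
    rw [lintegral_congr_ae hWe]
    have e : (fun y => ENNReal.ofReal (U.indicator ω y)) =
        U.indicator (fun y => ENNReal.ofReal (ω y)) := by
      ext y; by_cases hyU : y ∈ U <;> simp [hyU]
    rw [e, lintegral_indicator hUm, ← ofReal_integral_eq_lintegral_ofReal hωint
      (Filter.Eventually.of_forall hω), hω1, ENNReal.ofReal_one]
  set G : EuclideanSpace ℝ (Fin n) → ℝ≥0∞ :=
    U.indicator (fun z => ‖fderivWithin ℝ f (closure U) z‖ₑ ^ t) with hGdef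
  have hGm : Measurable G := by
    have h1 : ContinuousOn (fun z => ‖fderivWithin ℝ f (closure U) z‖ₑ ^ t) U :=
      ENNReal.continuous_rpow_const.comp_continuousOn (hcD.mono subset_closure).enorm
    classical
    rw [hGdef, ← piecewise_eq_indicator]
    exact h1.measurable_piecewise continuous_zero.continuousOn hUm
  have hfU : ContinuousOn f U := hf.continuousOn.mono subset_closure
  have hcomp : IsCompact (closure U) := hUb.isCompact_closure
  obtain ⟨M, hM⟩ := hcomp.exists_bound_of_continuousOn hf.continuousOn
  have hfω : IntegrableOn (fun y => f y * ω y) U := by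
    refine Integrable.bdd_mul hωint (hfU.aestronglyMeasurable hUm) (c := M) ?_
    filter_upwards [ae_restrict_mem hUm] with y hy using hM y (subset_closure hy)
  let μ : Measure (EuclideanSpace ℝ (Fin n)) := volume.withDensity W
  have hμ : IsProbabilityMeasure μ := ⟨by simp [μ, hW1]⟩
  have hJ : ∀ x, ‖f x - ∫ y in U, f y * ω y‖ₑ ^ t ≤ ∫⁻ y, W y * (U.indicator (fun y => ‖f x - f y‖ₑ ^ t) y) := by
    intro x
    have e1 : f x - ∫ y in U, f y * ω y = ∫ y in U, (f x - f y) * ω y := by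
      simp only [sub_mul]
      rw [integral_sub (hωint.const_mul _) hfω, integral_const_mul, hω1, mul_one]
    have e2 : ‖f x - ∫ y in U, f y * ω y‖ₑ ≤ ∫⁻ y, U.indicator (fun y => ‖f x - f y‖ₑ) y ∂μ := by
      rw [e1]
      refine (enorm_integral_le_lintegral_enorm _).trans ?_
      rw [lintegral_withDensity_eq_lintegral_mul₀' hWm.aemeasurable]
      · rw [← lintegral_indicator hUm]
        refine le_of_eq (lintegral_congr_ae ?_)
        filter_upwards [hWe] with y hy
        by_cases hyU : y ∈ U
        · simp only [hyU, indicator_of_mem, Pi.mul_apply, hy, enorm_mul]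
          rw [mul_comm, Real.enorm_of_nonneg (hω y)]
        · simp [hyU]
      · refine (AEMeasurable.mono_ac ?_ (withDensity_absolutelyContinuous _ _))
        refine (aemeasurable_indicator_iff hUm).2 ?_
        exact (continuousOn_const.sub hfU).enorm.aemeasurable hUm
    have hme : AEMeasurable (U.indicator (fun y => ‖f x - f y‖ₑ)) volume :=
      (aemeasurable_indicator_iff hUm).2 ((continuousOn_const.sub hfU).enorm.aemeasurable hUm)
    have hme' : AEMeasurable (U.indicator (fun y => ‖f x - f y‖ₑ)) μ :=
      hme.mono_ac (withDensity_absolutelyContinuous _ _)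
    refine (ENNReal.rpow_le_rpow e2 ht0).trans ((aux_jensen μ _ hme' t ht1).trans ?_)
    rw [lintegral_withDensity_eq_lintegral_mul₀' hWm.aemeasurable (hme'.pow_const t)]
    refine le_of_eq (lintegral_congr fun y => ?_)
    by_cases hyU : y ∈ U
    · simp [hyU]
    · simp [hyU, hWdef]
  have hN : Measurable (auxN d t : EuclideanSpace ℝ (Fin n) → ℝ≥0∞) := auxN_meas d t
  have hmI : Measurable (fun q : EuclideanSpace ℝ (Fin n) × EuclideanSpace ℝ (Fin n) =>
      ∫⁻ u in Ioo (0:ℝ) 1, G (q.2 + u • q.1)) :=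
    Measurable.lintegral_prod_right'
      (f := fun q : (EuclideanSpace ℝ (Fin n) × EuclideanSpace ℝ (Fin n)) × ℝ =>
        G (q.1.2 + q.2 • q.1.1)) (by fun_prop)
  have hmI' : Measurable (fun q : EuclideanSpace ℝ (Fin n) × EuclideanSpace ℝ (Fin n) =>
      ∫⁻ u in Ioo (0:ℝ) 1, G (q.2 + u • (q.1 - q.2))) :=
    hmI.comp (g := fun q : EuclideanSpace ℝ (Fin n) × EuclideanSpace ℝ (Fin n) =>
      ∫⁻ u in Ioo (0:ℝ) 1, G (q.2 + u • q.1))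
      (f := fun q : EuclideanSpace ℝ (Fin n) × EuclideanSpace ℝ (Fin n) => (q.1 - q.2, q.2)) (by fun_prop)
  calc (∫⁻ x in U, ENNReal.ofReal (|f x - ∫ y in U, f y * ω y| ^ t))
      ≤ ∫⁻ x in U, ∫⁻ y, W y * (auxN d t (x - y) *
          ∫⁻ u in Ioo (0:ℝ) 1, G (y + u • (x - y))) := by
        refine setLIntegral_mono' hUm fun x hx => ?_
        rw [hofr]
        refine (hJ x).trans (lintegral_mono fun y => ?_)
        by_cases hyU : y ∈ U
        · rw [indicator_of_mem hyU]
          gcongr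
          have hxy : ‖x - y‖ ≤ d := by
            rw [← dist_eq_norm, ← hd]
            exact Metric.dist_le_diam_of_mem hUb hx hyU
          have : auxN d t (x - y) = ‖x - y‖ₑ ^ t := by
            rw [auxN, indicator_of_mem (by simpa using hxy),
              ← ENNReal.ofReal_rpow_of_nonneg (norm_nonneg _) ht0, ofReal_norm]
          rw [this]
          exact aux_pointwise n U hUo hUc f hf t ht1 x y hx hyU
        · simp [hyU]
    _ ≤ ∫⁻ x, ∫⁻ y, W y * (auxN d t (x - y) *
          ∫⁻ u in Ioo (0:ℝ) 1, G (y + u • (x - y))) := setLIntegral_le_lintegral _ _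
    _ = ∫⁻ y, ∫⁻ x, W y * (auxN d t (x - y) *
          ∫⁻ u in Ioo (0:ℝ) 1, G (y + u • (x - y))) := by
        rw [lintegral_lintegral_swap]
        refine Measurable.aemeasurable ?_
        unfold Function.uncurry
        exact (hWm.comp measurable_snd).mul
          ((hN.comp (measurable_fst.sub measurable_snd)).mul hmI')
    _ = ∫⁻ y, W y * ∫⁻ h, auxN d t h * ∫⁻ u in Ioo (0:ℝ) 1, G (y + u • h) := by
        refine lintegral_congr fun y => ?_
        rw [lintegral_sub_right_eq_self (μ := volume) (fun h => W y * (auxN d t h *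
          ∫⁻ u in Ioo (0:ℝ) 1, G (y + u • h))) y]
        rw [lintegral_const_mul]
        exact hN.mul (hmI.comp (g := fun q : EuclideanSpace ℝ (Fin n) × EuclideanSpace ℝ (Fin n) =>
          ∫⁻ u in Ioo (0:ℝ) 1, G (q.2 + u • q.1)) (f := fun h => (h, y)) (by fun_prop))
    _ ≤ ENNReal.ofReal (d ^ (n + t - 1)) *
        ∫⁻ z, G z * ∫⁻ w, W (z - w) * auxN d (-((n:ℝ) - 1)) w :=
        aux_core n hn d t ht1 W G hWm hGm
    _ ≤ _ := by
        refine mul_le_mul_right ?_ _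
        rw [← lintegral_indicator hUm]
        refine lintegral_mono_ae ?_
        have hconv := (aux_Kint n hn d).ae_convolution_exists (ContinuousLinearMap.mul ℝ ℝ)
          ((integrable_indicator_iff hUm).2 hωint)
        filter_upwards [hconv] with z hz
        by_cases hzU : z ∈ U
        swap
        · simp [hGdef, hzU]
        rw [indicator_of_mem hzU, hGdef, indicator_of_mem hzU]
        have hz' : Integrable (fun x => Set.indicator U ω (z - x) *
              Set.indicator {x : EuclideanSpace ℝ (Fin n) | ‖x‖ ≤ d}
                (fun x => ‖x‖ ^ (-((n : ℝ) - 1))) x) := by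
          refine Integrable.congr hz (Filter.Eventually.of_forall fun x => ?_)
          simp only [ContinuousLinearMap.mul_apply']
          rw [mul_comm]
        have hnn : ∀ x, 0 ≤ Set.indicator U ω (z - x) := fun x =>
          indicator_nonneg (fun x _ => hω x) _
        have hnn2 : ∀ x : EuclideanSpace ℝ (Fin n),
            0 ≤ Set.indicator {x : EuclideanSpace ℝ (Fin n) | ‖x‖ ≤ d}
                (fun x => ‖x‖ ^ (-((n : ℝ) - 1))) x := fun x =>
          indicator_nonneg (fun x _ => by positivity) _
        rw [ENNReal.ofReal_mul (integral_nonneg fun x => mul_nonneg (hnn x) (hnn2 x)),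
          ofReal_integral_eq_lintegral_ofReal hz'
            (Filter.Eventually.of_forall fun x => mul_nonneg (hnn x) (hnn2 x)),
          ← ENNReal.ofReal_rpow_of_nonneg (norm_nonneg _) ht0, ofReal_norm, mul_comm]
        gcongr ?_ * _
        refine le_of_eq (lintegral_congr_ae ?_)
        have hq := (quasiMeasurePreserving_sub_left volume z).ae hWe
        filter_upwards [hq] with w hw
        rw [hw, ENNReal.ofReal_mul (hnn w)]
        congr 1
        by_cases hwd : ‖w‖ ≤ d
        · simp [auxN, hwd]
        · simp [auxN, hwd]
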